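/- arXiv:2502.06273 — 2 statements merged into one kernel-verified Lean document; each statement's English description precedes it below -/
import Mathlib

section
/- Let n ≥ 3, 2* := 2n/(n−2), let 2 < ν < 2*, ŝ ≥ 1, R' > 0, x₀ ∈ ℝ^n, and let g : ℝ^n → [0,∞) be measurable with g ∈ L^q(B_{2R'}(x₀)) for every 1 ≤ q < ∞. Suppose there exists A ≥ 1 such that for every q ≥ ŝ and all radii R' ≤ h' < h ≤ 2R': (∫_{B_{h'}(x₀)} g^{2*q} dx)^{1/2*} ≤ (A q/(h − h')) · (∫_{B_h(x₀)} g^{ν(q−ŝ)} dx)^{1/ν}. Then g is essentially bounded on B_{R'}(x₀), and its essential supremum on B_{R'}(x₀) is bounded by a constant depending only on n, ν, ŝ, R' and A. -/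
open MeasureTheory Metric Real Set
open scoped RealInnerProductSpace ENNReal Topology

noncomputable section

abbrev Euc (n : ℕ) : Type := EuclideanSpace ℝ (Fin n)

/-- The `i`-th partial derivative of `u`. -/
noncomputable def pd {n : ℕ} (i : Fin n) (u : Euc n → ℝ) (x : Euc n) : ℝ :=
  fderiv ℝ u x (EuclideanSpace.single i 1)

/-- The second partial derivative `u_{ij} = ∂²u/∂xⱼ∂xᵢ`. -/
noncomputable def pd2 {n : ℕ} (i j : Fin n) (u : Euc n → ℝ) (x : Euc n) : ℝ :=
  fderiv ℝ (pd i u) x (EuclideanSpace.single j 1)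

/-- Frobenius norm of the Hessian matrix of `u` at `x`. -/
noncomputable def hessNorm {n : ℕ} (u : Euc n → ℝ) (x : Euc n) : ℝ :=
  Real.sqrt (∑ i : Fin n, ∑ j : Fin n, pd2 i j u x ^ 2)

/-- `u` is a weak solution of `-Δ_p u = f` on `Ω`. -/
def IsWeakPSol {n : ℕ} (p : ℝ) (f u : Euc n → ℝ) (Ω : Set (Euc n)) : Prop :=
  ∀ ψ : Euc n → ℝ, ContDiff ℝ (⊤ : ℕ∞) ψ → HasCompactSupport ψ → tsupport ψ ⊆ Ω →
    (∫ x in Ω, ‖gradient u x‖ ^ (p - 2) * ⟪gradient u x, gradient ψ x⟫) =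
      ∫ x in Ω, f x * ψ x

/-- `u` solves the regularized problem `-div((ε + |∇u|²)^((p-2)/2) ∇u) = f` pointwise on `B`. -/
def SolvesReg {n : ℕ} (p ε : ℝ) (f u : Euc n → ℝ) (B : Set (Euc n)) : Prop :=
  ∀ x ∈ B,
    -(∑ i : Fin n,
        fderiv ℝ (fun y => (((ε + ‖gradient u y‖ ^ 2) ^ ((p - 2) / 2)) • gradient u y) i) x
          (EuclideanSpace.single i 1)) = f x

/-- The weighted function `g_ε(x) = (ε + |∇u(x)|²)^(k/2) |u_{ij}(x)|`. -/
noncomputable def gfun {n : ℕ} (k ε : ℝ) (i j : Fin n) (u : Euc n → ℝ) (x : Euc n) : ℝ :=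
  (ε + ‖gradient u x‖ ^ 2) ^ (k / 2) * |pd2 i j u x|

/-- The `L^e` norm of `g` on the set `s`. -/
noncomputable def lpOn {n : ℕ} (g : Euc n → ℝ) (e : ℝ) (s : Set (Euc n)) : ℝ :=
  (∫ x in s, g x ^ e) ^ (1 / e)

def qseq (κ s : ℝ) : ℕ → ℝ
  | 0 => s
  | i + 1 => κ * qseq κ s i + s

lemma qseq_facts {κ s : ℝ} (hκ : 1 < κ) (hs : 1 ≤ s) (i : ℕ) :
    s ≤ qseq κ s i ∧ (i : ℝ) ≤ qseq κ s i ∧ qseq κ s i ≤ s * (κ + 1) ^ i := by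
  induction i with
  | zero => simp [qseq]; linarith
  | succ i ih =>
    obtain ⟨h1, h2, h3⟩ := ih
    have h4 : qseq κ s i ≤ κ * qseq κ s i := by nlinarith
    have h5 : (1 : ℝ) ≤ (κ + 1) ^ i := one_le_pow₀ (by linarith)
    refine ⟨?_, ?_, ?_⟩
    · simp only [qseq]; linarith
    · simp only [qseq]; push_cast; linarith
    · simp only [qseq]
      have h6 : κ * qseq κ s i ≤ κ * (s * (κ + 1) ^ i) :=
        mul_le_mul_of_nonneg_left h3 (by linarith)
      have h7 : s ≤ s * (κ + 1) ^ i := by nlinarith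
      rw [pow_succ]
      nlinarith

lemma iter_bound {κ s B α L c : ℝ} (hκ : 1 < κ) (hs : 1 ≤ s) (hB1 : 1 ≤ B)
    (hα : α = 1 / (κ - 1)) (hL : L = 2 + α) (hc : 0 ≤ c) (hcB : c ≤ B)
    (hκB : 2 * (κ + 1) ≤ B)
    (a : ℕ → ℝ) (ha : ∀ i, 0 ≤ a i) (h0 : a 0 ≤ B)
    (hstep : ∀ i, a (i + 1) ≤ c * 2 ^ (i + 1) * (qseq κ s (i + 1) / s) * a i ^ κ) (i : ℕ) :
    a i ≤ B ^ (L * qseq κ s i - α * i) := by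
  have hB0 : 0 < B := by linarith
  have hα0 : 0 < α := by rw [hα]; exact div_pos one_pos (by linarith)
  have hακ : (κ - 1) * α = 1 := by
    rw [hα]; field_simp [show κ - 1 ≠ 0 by linarith]
  induction i with
  | zero =>
    refine h0.trans ?_
    conv_lhs => rw [← Real.rpow_one B]
    apply Real.rpow_le_rpow_of_exponent_le hB1
    simp [qseq]; nlinarith
  | succ i ih =>
    have hq := (qseq_facts hκ hs (i + 1))
    have h1 : qseq κ s (i + 1) / s ≤ (κ + 1) ^ (i + 1) := by
      rw [div_le_iff₀ (by linarith)]; linarith [hq.2.2]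
    have h2 : c * 2 ^ (i + 1) * (qseq κ s (i + 1) / s) ≤ B ^ ((i : ℝ) + 2) := by
      calc c * 2 ^ (i + 1) * (qseq κ s (i + 1) / s)
          ≤ c * 2 ^ (i + 1) * (κ + 1) ^ (i + 1) :=
            mul_le_mul_of_nonneg_left h1 (by positivity)
        _ = c * (2 * (κ + 1)) ^ (i + 1) := by rw [mul_pow]; ring
        _ ≤ B * B ^ (i + 1) := by
            apply mul_le_mul hcB _ (by positivity) hB0.le
            exact pow_le_pow_left₀ (by linarith) hκB _
        _ = B ^ ((i : ℝ) + 2) := by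
            rw [show ((i : ℝ) + 2) = ((i + 2 : ℕ) : ℝ) by push_cast; ring, Real.rpow_natCast]
            ring
    have h3 : a i ^ κ ≤ B ^ ((L * qseq κ s i - α * i) * κ) := by
      rw [Real.rpow_mul hB0.le]
      exact Real.rpow_le_rpow (ha i) ih (by linarith)
    calc a (i + 1) ≤ _ := hstep i
      _ ≤ B ^ ((i : ℝ) + 2) * B ^ ((L * qseq κ s i - α * i) * κ) :=
          mul_le_mul h2 h3 (Real.rpow_nonneg (ha i) _) (Real.rpow_nonneg hB0.le _)
      _ = B ^ ((i : ℝ) + 2 + (L * qseq κ s i - α * i) * κ) := (Real.rpow_add hB0 _ _).symm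
      _ ≤ _ := by
          apply Real.rpow_le_rpow_of_exponent_le hB1
          simp only [qseq]; push_cast
          have : L ≤ L * s := by nlinarith
          have h8 : (κ - 1) * α * i = i := by rw [hακ, one_mul]
          nlinarith

lemma ae_of_bounds {X : Type*} [MeasurableSpace X] (μ : Measure X) (g : X → ℝ)
    (hg : ∀ x, 0 ≤ g x) (K : ℝ) (hK : 0 < K) (p : ℕ → ℝ) (hp : ∀ i : ℕ, (i : ℝ) ≤ p i)
    (hp1 : ∀ i, 0 < p i)
    (hint : ∀ i, Integrable (fun x => g x ^ p i) μ)
    (hb : ∀ i, ∫ x, g x ^ p i ∂μ ≤ K ^ p i) : ∀ᵐ x ∂μ, g x ≤ 2 * K := by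
  set T : Set X := {x | 2 * K ≤ g x} with hT
  have hset : ∀ i, {x | (2 * K) ^ p i ≤ g x ^ p i} = T := by
    intro i; ext x
    simp only [hT, mem_ofPred_eq]
    exact Real.rpow_le_rpow_iff (by positivity) (hg x) (hp1 i)
  have hfin : μ T < ∞ := by
    rw [← hset 0]
    exact (hint 0).measure_ge_lt_top (by positivity)
  have hle : ∀ i : ℕ, μ.real T ≤ (1 / 2 : ℝ) ^ i := by
    intro i
    have h1 := mul_meas_ge_le_integral_of_nonneg (μ := μ) (f := fun x => g x ^ p i)
      (Filter.Eventually.of_forall fun x => Real.rpow_nonneg (hg x) _) (hint i) ((2 * K) ^ p i)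
    rw [hset i, Real.mul_rpow (by norm_num) hK.le] at h1
    have h2 := h1.trans (hb i)
    have hKp : 0 < K ^ p i := by positivity
    have h3 : (2 : ℝ) ^ p i * μ.real T ≤ 1 := by
      by_contra hcon
      push Not at hcon
      nlinarith
    have h4 : (2 : ℝ) ^ i ≤ 2 ^ p i := by
      rw [← Real.rpow_natCast]
      exact Real.rpow_le_rpow_of_exponent_le (by norm_num) (hp i)
    rw [one_div, inv_pow, ← one_div, le_div_iff₀ (by positivity)]
    have : 0 ≤ μ.real T := measureReal_nonneg
    nlinarith
  have h0 : μ.real T ≤ 0 :=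
    ge_of_tendsto' (tendsto_pow_atTop_nhds_zero_of_lt_one (by norm_num) (by norm_num)) hle
  have h1 : μ T = 0 := by
    have := le_antisymm h0 measureReal_nonneg
    rwa [measureReal_eq_zero_iff hfin.ne] at this
  rw [ae_iff]
  refine measure_mono_null ?_ h1
  intro x hx
  simp only [mem_ofPred_eq, not_le] at hx
  exact hx.le

/-- The abstract Moser-type iteration lemma encapsulating the proof of Proposition 3.4:
a reverse-Hölder inequality along all exponents `q ≥ ŝ` and radii `R' ≤ h' < h ≤ 2R'`
yields an essential bound on `B_{R'}` depending only on `n`, `ν`, `ŝ`, `R'` and `A`. -/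
theorem stmt6 (n : ℕ) (hn : 3 ≤ n) (ν s R' A : ℝ)
    (hν2 : 2 < ν) (hν : ν < 2 * (n : ℝ) / ((n : ℝ) - 2)) (hs : 1 ≤ s) (hR' : 0 < R')
    (hA : 1 ≤ A) :
    ∃ C : ℝ,
      ∀ (x₀ : Euc n) (g : Euc n → ℝ),
        Measurable g → (∀ x, 0 ≤ g x) →
        (∀ q : ℝ, 1 ≤ q → IntegrableOn (fun x => g x ^ q) (ball x₀ (2 * R'))) →
        (∀ q : ℝ, s ≤ q →
          ∀ h' h : ℝ, R' ≤ h' → h' < h → h ≤ 2 * R' →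
            (∫ x in ball x₀ h', g x ^ (2 * (n : ℝ) / ((n : ℝ) - 2) * q)) ^
                (((n : ℝ) - 2) / (2 * (n : ℝ))) ≤
              A * q / (h - h') * (∫ x in ball x₀ h, g x ^ (ν * (q - s))) ^ (1 / ν)) →
        ∀ᵐ x ∂volume.restrict (ball x₀ R'), g x ≤ C := by
  have hn' : (3 : ℝ) ≤ n := by exact_mod_cast hn
  obtain ⟨S, hS⟩ : ∃ S : ℝ, S = 2 * (n : ℝ) / ((n : ℝ) - 2) := ⟨_, rfl⟩
  have hSinv : ((n : ℝ) - 2) / (2 * (n : ℝ)) = 1 / S := by rw [hS, one_div_div]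
  rw [hSinv]
  simp only [← hS] at hν ⊢
  have hS0 : 0 < S := by linarith
  have hν0 : 0 < ν := by linarith
  obtain ⟨κ, hκd⟩ : ∃ κ : ℝ, κ = S / ν := ⟨_, rfl⟩
  have hκ : 1 < κ := by rw [hκd, one_lt_div hν0]; exact hν
  obtain ⟨V, hV⟩ : ∃ V : ℝ, V = volume.real (ball (0 : Euc n) (2 * R')) := ⟨_, rfl⟩
  have hV0 : 0 ≤ V := hV ▸ measureReal_nonneg
  have hVν : 0 ≤ V ^ (1 / ν) := Real.rpow_nonneg hV0 _
  obtain ⟨α, hα⟩ : ∃ α : ℝ, α = 1 / (κ - 1) := ⟨_, rfl⟩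
  have hα0 : 0 < α := by rw [hα]; exact div_pos one_pos (by linarith)
  obtain ⟨c, hc⟩ : ∃ c : ℝ, c = 2 * A * s / R' := ⟨_, rfl⟩
  have hc0 : 0 ≤ c := by rw [hc]; positivity
  obtain ⟨B, hB⟩ : ∃ B : ℝ, B = 1 + c + 2 * (κ + 1) + c * V ^ (1 / ν) + c := ⟨_, rfl⟩
  have hcV : 0 ≤ c * V ^ (1 / ν) := by positivity
  have hB1 : 1 ≤ B := by linarith
  have hB0 : 0 < B := by linarith
  refine ⟨2 * B ^ (2 + α), ?_⟩
  intro x₀ g hgm hg hint hyp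
  let r : ℕ → ℝ := fun i => R' * (1 + (1 / 2) ^ (i + 1))
  have hr1 : ∀ i, R' ≤ r i := by
    intro i
    have : (0 : ℝ) < (1 / 2) ^ (i + 1) := by positivity
    simp only [r]; nlinarith
  have hr2 : ∀ i, r i ≤ 2 * R' := by
    intro i
    have : (1 / 2 : ℝ) ^ (i + 1) ≤ 1 := pow_le_one₀ (by norm_num) (by norm_num)
    simp only [r]; nlinarith
  have hrd : ∀ i, r i - r (i + 1) = R' / 2 ^ (i + 2) := by
    intro i
    simp only [r, one_div, inv_pow]
    field_simp
    ring
  have hIn : ∀ i, 0 ≤ ∫ x in ball x₀ (r i), g x ^ (S * qseq κ s i) := fun i =>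
    integral_nonneg fun x => Real.rpow_nonneg (hg x) _
  let a : ℕ → ℝ := fun i => (∫ x in ball x₀ (r i), g x ^ (S * qseq κ s i)) ^ (1 / S)
  have ha : ∀ i, 0 ≤ a i := fun i => Real.rpow_nonneg (hIn i) _
  have h0 : a 0 ≤ B := by
    have hr0 : r 0 = R' * (3 / 2) := by simp only [r]; norm_num
    have h := hyp s le_rfl (r 0) (2 * R') (hr1 0) (by rw [hr0]; linarith) le_rfl
    have hvol : ∫ x in ball x₀ (2 * R'), g x ^ (ν * (s - s)) = V := by
      simp only [sub_self, mul_zero, Real.rpow_zero]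
      simp only [integral_const, MeasurableSet.univ, measureReal_restrict_apply, univ_inter,
        smul_eq_mul, mul_one]
      rw [hV, measureReal_def, measureReal_def, Measure.addHaar_ball_center]
    rw [hvol] at h
    have hcc : A * s / (2 * R' - r 0) = c := by
      rw [hr0, hc, show 2 * R' - R' * (3 / 2) = R' / 2 by ring]
      field_simp
    rw [hcc] at h
    exact h.trans (by linarith)
  have hstep : ∀ i, a (i + 1) ≤ c * 2 ^ (i + 1) * (qseq κ s (i + 1) / s) * a i ^ κ := by
    intro i
    have hd := hrd i
    have hdp : 0 < R' / 2 ^ (i + 2) := by positivity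
    have h := hyp (qseq κ s (i + 1)) (qseq_facts hκ hs (i + 1)).1 (r (i + 1)) (r i)
      (hr1 _) (by linarith) (hr2 _)
    have he : ν * (qseq κ s (i + 1) - s) = S * qseq κ s i := by
      simp only [qseq, hκd]; field_simp; ring
    rw [he, hd] at h
    refine h.trans (le_of_eq ?_)
    congr 1
    · rw [hc]; field_simp; ring
    · simp only [a]
      rw [← Real.rpow_mul (hIn i)]
      congr 1
      rw [hκd]; field_simp
  have hit := iter_bound hκ hs hB1 hα rfl hc0 (by linarith) (by linarith) a ha h0 hstep
  have hq1 : ∀ i : ℕ, 1 ≤ S * qseq κ s i ∧ (i : ℝ) ≤ S * qseq κ s i := by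
    intro i
    obtain ⟨h1, h2, -⟩ := qseq_facts hκ hs i
    constructor <;> nlinarith
  refine ae_of_bounds _ g hg (B ^ (2 + α)) (by positivity) (fun i => S * qseq κ s i)
    (fun i => (hq1 i).2) (fun i => by linarith [(hq1 i).1]) ?_ ?_
  · intro i
    exact (hint _ (hq1 i).1).mono_set (ball_subset_ball (by linarith))
  · intro i
    have h1 : ∫ x in ball x₀ R', g x ^ (S * qseq κ s i)
        ≤ ∫ x in ball x₀ (r i), g x ^ (S * qseq κ s i) := by
      apply setIntegral_mono_set ((hint _ (hq1 i).1).mono_set (ball_subset_ball (hr2 i)))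
      · exact Filter.Eventually.of_forall fun x => Real.rpow_nonneg (hg x) _
      · exact (ball_subset_ball (hr1 i)).eventuallyLE
    refine h1.trans ?_
    have h2 : a i ≤ B ^ ((2 + α) * qseq κ s i) := by
      refine (hit i).trans (Real.rpow_le_rpow_of_exponent_le hB1 ?_)
      have : 0 ≤ α * i := by positivity
      linarith
    have h3 := Real.rpow_le_rpow (ha i) h2 hS0.le
    simp only [a] at h3
    rw [← Real.rpow_mul (hIn i), one_div_mul_cancel hS0.ne', Real.rpow_one,
      ← Real.rpow_mul hB0.le] at h3
    refine h3.trans (le_of_eq ?_)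
    rw [← Real.rpow_mul hB0.le]
    congr 1; ring

end
end

section
/- Let n ≥ 1, p > 2, k > 0, and define u : ℝ^n → ℝ by u(x) = ((p−1)/p)·|x₁|^{p/(p−1)}, and w : {x ∈ ℝ^n : x₁ ≠ 0} → ℝ by w(x) := |∇u(x)|^k · |∂²u/∂x₁²(x)|. Then w(x) = (1/(p−1))·|x₁|^{(k+2−p)/(p−1)} for every x with x₁ ≠ 0, and the following dichotomy holds: if p ≤ 2 + k, then w is bounded on B ∩ {x₁ ≠ 0} for every bounded set B ⊂ ℝ^n; if p > 2 + k, then w is unbounded on Ω ∩ {x₁ ≠ 0} for every open set Ω ⊆ ℝ^n with Ω ∩ {x : x₁ = 0} ≠ ∅. -/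
open MeasureTheory Metric Real Set
open scoped RealInnerProductSpace ENNReal Topology

noncomputable section

lemma aux_fderiv {n : ℕ} (i : Fin n) (f : ℝ → ℝ) (f' : ℝ) (x : Euc n)
    (h : HasDerivAt f f' (x i)) :
    HasFDerivAt (fun y : Euc n => f (y i)) (f' • (EuclideanSpace.proj i : Euc n →L[ℝ] ℝ)) x := by
  have h2 : HasFDerivAt (fun y : Euc n => y i) (EuclideanSpace.proj i : Euc n →L[ℝ] ℝ) x :=
    (EuclideanSpace.proj i : Euc n →L[ℝ] ℝ).hasFDerivAt
  exact h.comp_hasFDerivAt x h2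

lemma aux_w (n : ℕ) (i : Fin n) (p k : ℝ) (hp : 2 < p) (x : Euc n) (hx : x i ≠ 0) :
    ‖gradient (fun x : Euc n => (p - 1) / p * |x i| ^ (p / (p - 1))) x‖ ^ k *
      |pd2 i i (fun x : Euc n => (p - 1) / p * |x i| ^ (p / (p - 1))) x| =
      1 / (p - 1) * |x i| ^ ((k + 2 - p) / (p - 1)) := by
  set q := p / (p - 1) with hq
  have hp1 : 0 < p - 1 := by linarith
  have hp0 : p ≠ 0 := by linarith
  have hq1 : 1 < q := by rw [hq, lt_div_iff₀ hp1]; linarith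
  have hqq : q - 1 = 1 / (p - 1) := by rw [hq]; field_simp; ring
  have hpos : 0 < |x i| := abs_pos.mpr hx
  have h1 : ∀ t : ℝ, HasDerivAt (fun t : ℝ => (p - 1) / p * |t| ^ q) (|t| ^ (q - 2) * t) t := by
    intro t
    have := (hasDerivAt_abs_rpow t hq1).const_mul ((p - 1) / p)
    convert! this using 1
    have : (p - 1) / p * q = 1 := by rw [hq]; field_simp
    linear_combination (-(|t| ^ (q - 2) * t)) * this
  have hF : ∀ y : Euc n, HasFDerivAt (fun x : Euc n => (p - 1) / p * |x i| ^ q)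
      ((|y i| ^ (q - 2) * y i) • (EuclideanSpace.proj i : Euc n →L[ℝ] ℝ)) y :=
    fun y => aux_fderiv i _ _ y (h1 (y i))
  have hpd : pd i (fun x : Euc n => (p - 1) / p * |x i| ^ q)
      = fun y : Euc n => |y i| ^ (q - 2) * y i := by
    funext y
    simp [pd, (hF y).fderiv]
  have h2 : HasDerivAt (fun t : ℝ => |t| ^ (q - 2) * t) ((q - 1) * |x i| ^ (q - 2)) (x i) := by
    have := ((hasDerivAt_abs hx).rpow_const (p := q - 2) (Or.inl hpos.ne')).mul
      (hasDerivAt_id (x i))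
    convert! this using 1
    have e : |x i| ^ (q - 2) = |x i| ^ (q - 2 - 1) * |x i| := by
      rw [Real.rpow_sub_one hpos.ne']; field_simp
    have s : (SignType.sign (x i) : ℝ) * x i = |x i| := sign_mul_self (x i)
    simp only [id]
    linear_combination (q - 2) * e - (q - 2) * |x i| ^ (q - 2 - 1) * s
  have hpd2 : pd2 i i (fun x : Euc n => (p - 1) / p * |x i| ^ q) x
      = (q - 1) * |x i| ^ (q - 2) := by
    rw [pd2, hpd, (aux_fderiv i _ _ x h2).fderiv]
    simp
  have hG : gradient (fun x : Euc n => (p - 1) / p * |x i| ^ q) x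
      = (|x i| ^ (q - 2) * x i) • EuclideanSpace.single i (1 : ℝ) := by
    apply HasGradientAt.gradient
    rw [hasGradientAt_iff_hasFDerivAt]
    convert! hF x using 1
    ext v
    simp [InnerProductSpace.toDual_apply_apply, inner_smul_left, EuclideanSpace.inner_single_left]
  have hN : ‖gradient (fun x : Euc n => (p - 1) / p * |x i| ^ q) x‖ = |x i| ^ (q - 1) := by
    rw [hG, norm_smul]
    simp only [EuclideanSpace.norm_single, norm_one, mul_one, Real.norm_eq_abs, abs_mul]
    rw [abs_of_pos (Real.rpow_pos_of_pos hpos _), ← Real.rpow_add_one hpos.ne']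
    congr 1; ring
  rw [hN, hpd2, abs_of_nonneg (mul_nonneg (by linarith) (Real.rpow_nonneg hpos.le _)),
    ← Real.rpow_mul hpos.le, mul_left_comm, ← Real.rpow_add hpos, hqq]
  congr 2
  rw [hq]; field_simp; ring

/-- The dichotomy of Remark 1.2: for `u(x) = ((p-1)/p) |x₁|^{p/(p-1)}` with `p > 2` and
`w = |∇u|^k |∂²u/∂x₁²|`, one has `w = (1/(p-1)) |x₁|^{(k+2-p)/(p-1)}` away from
`{x₁ = 0}`; `w` is bounded on bounded sets iff `p ≤ 2 + k` and unbounded near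
`{x₁ = 0}` if `p > 2 + k`. -/
theorem stmt13 (n : ℕ) (hn : 1 ≤ n) (p k : ℝ) (hp : 2 < p) (hk : 0 < k) :
    let i0 : Fin n := ⟨0, hn⟩
    let u : Euc n → ℝ := fun x => (p - 1) / p * |x i0| ^ (p / (p - 1))
    let w : Euc n → ℝ := fun x => ‖gradient u x‖ ^ k * |pd2 i0 i0 u x|
    (∀ x : Euc n, x i0 ≠ 0 →
        w x = 1 / (p - 1) * |x i0| ^ ((k + 2 - p) / (p - 1))) ∧
    (p ≤ 2 + k →
      ∀ B : Set (Euc n), Bornology.IsBounded B →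
        ∃ M : ℝ, ∀ x ∈ B, x i0 ≠ 0 → w x ≤ M) ∧
    (2 + k < p →
      ∀ Ω : Set (Euc n), IsOpen Ω → (Ω ∩ {x : Euc n | x i0 = 0}).Nonempty →
        ∀ M : ℝ, ∃ x ∈ Ω, x i0 ≠ 0 ∧ M < w x) := by
  intro i0 u w
  have hw : ∀ x : Euc n, x i0 ≠ 0 →
      w x = 1 / (p - 1) * |x i0| ^ ((k + 2 - p) / (p - 1)) :=
    fun x hx => aux_w n i0 p k hp x hx
  have hp1 : 0 < p - 1 := by linarith
  refine ⟨hw, ?_, ?_⟩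
  · intro hpk B hB
    obtain ⟨R, hR⟩ := hB.exists_norm_le
    refine ⟨1 / (p - 1) * R ^ ((k + 2 - p) / (p - 1)), fun x hxB hx => ?_⟩
    rw [hw x hx]
    have h1 : |x i0| ≤ R := (PiLp.norm_apply_le x i0).trans (hR x hxB)
    have h2 : 0 ≤ (k + 2 - p) / (p - 1) := div_nonneg (by linarith) hp1.le
    have h3 := Real.rpow_le_rpow (abs_nonneg (x i0)) h1 h2
    exact mul_le_mul_of_nonneg_left h3 (by positivity)
  · rintro hpk Ω hΩ ⟨x0, hx0, hx00⟩ M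
    have hx00 : x0 i0 = 0 := hx00
    have he : (k + 2 - p) / (p - 1) < 0 := div_neg_of_neg_of_pos (by linarith) hp1
    have ht := (tendsto_rpow_neg_nhdsGT_zero he).eventually_gt_atTop (M * (p - 1))
    have hc : Continuous fun t : ℝ => x0 + t • (EuclideanSpace.single i0 (1 : ℝ) : Euc n) := by
      fun_prop
    have hO : ∀ᶠ t in 𝓝[>] (0 : ℝ),
        x0 + t • (EuclideanSpace.single i0 (1 : ℝ) : Euc n) ∈ Ω := by
      apply Filter.Eventually.filter_mono nhdsWithin_le_nhds
      apply hc.continuousAt.eventually_mem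
      apply hΩ.mem_nhds
      simpa using hx0
    obtain ⟨t, ⟨h1, h2⟩, h3⟩ := ((ht.and hO).and self_mem_nhdsWithin).exists
    have h3 : 0 < t := h3
    have hv : (x0 + t • (EuclideanSpace.single i0 (1 : ℝ) : Euc n)) i0 = t := by
      simp [hx00]
    refine ⟨_, h2, by rw [hv]; exact h3.ne', ?_⟩
    rw [hw _ (by rw [hv]; exact h3.ne'), hv, abs_of_pos h3, one_div_mul_eq_div,
      lt_div_iff₀ hp1]
    exact h1

end
end
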